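/- If A is a π-inductive algebra and A_1 ≠ 0, then dim A_b ≥ 1 for every b ∈ k (including b = 0), and consequently dim A ≥ q. -/

import Mathlib

open scoped BigOperators

namespace AffineInductive

variable {k : Type*} [Field k]

/-- The operator `π(a,b)` on functions `kˣ → ℂ`:
`(π(a,b)F)(a') = χ(a'·b) · F(a'·a)`. -/
noncomputable def piRep (χ : AddChar k ℂ) (a : kˣ) (b : k) :
    (kˣ → ℂ) ≃ₗ[ℂ] (kˣ → ℂ) where
  toFun F := fun a' => χ ((a' : k) * b) * F (a' * a)
  map_add' F G := by funext a'; simp [mul_add]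
  map_smul' c F := by funext a'; simp [smul_eq_mul]; ring
  invFun G := fun x => χ (-(((x * a⁻¹ : kˣ) : k) * b)) * G (x * a⁻¹)
  left_inv F := by
    funext x
    have h : χ (-(((x * a⁻¹ : kˣ) : k) * b)) * χ (((x * a⁻¹ : kˣ) : k) * b) = 1 := by
      rw [← AddChar.map_add_eq_mul]; simp
    simp only []
    rw [← mul_assoc, h, one_mul, inv_mul_cancel_right]
  right_inv G := by
    funext a'
    have h : χ (((a' : k)) * b) * χ (-(((a' * a * a⁻¹ : kˣ) : k) * b)) = 1 := by
      rw [← AddChar.map_add_eq_mul]; simp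
    simp only []
    rw [← mul_assoc, h, one_mul, mul_inv_cancel_right]

/-- The multiplication operator `m_φ`. -/
def mulOp (φ : kˣ → ℂ) : Module.End ℂ (kˣ → ℂ) where
  toFun F := fun a' => φ a' * F a'
  map_add' F G := by funext a'; simp [mul_add]
  map_smul' c F := by funext a'; simp [smul_eq_mul]; ring

/-- A `π`-inductive algebra: a commutative subalgebra of `End(H)` stable under
conjugation by every `π(a,b)`. -/
def IsInductive (χ : AddChar k ℂ) (A : Subalgebra ℂ (Module.End ℂ (kˣ → ℂ))) : Prop :=
  (∀ T ∈ A, ∀ S ∈ A, T * S = S * T) ∧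
  ∀ T ∈ A, ∀ (a : kˣ) (b : k),
    (piRep χ a b).toLinearMap * T * (piRep χ a b).symm.toLinearMap ∈ A

/-- The weight space `A_b = {T ∈ A | π(1,b') T π(1,b')⁻¹ = χ(b·b') T for all b'}`. -/
noncomputable def weightSpace (χ : AddChar k ℂ)
    (A : Subalgebra ℂ (Module.End ℂ (kˣ → ℂ))) (b : k) :
    Submodule ℂ (Module.End ℂ (kˣ → ℂ)) where
  carrier := {T | T ∈ A ∧ ∀ b' : k,
    (piRep χ 1 b').toLinearMap * T * (piRep χ 1 b').symm.toLinearMap = χ (b * b') • T}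
  add_mem' := by
    rintro T S ⟨hTA, hT⟩ ⟨hSA, hS⟩
    refine ⟨add_mem hTA hSA, fun b' => ?_⟩
    rw [mul_add, add_mul, hT b', hS b', smul_add]
  zero_mem' := ⟨zero_mem A, fun b' => by simp⟩
  smul_mem' := by
    rintro c T ⟨hTA, hT⟩
    refine ⟨A.smul_mem hTA c, fun b' => ?_⟩
    rw [mul_smul_comm, smul_mul_assoc, hT b', smul_comm]

/-- The inner product on `H`. -/
noncomputable def inn [Fintype k] [DecidableEq k] (F G : kˣ → ℂ) : ℂ :=
  ∑ a' : kˣ, F a' * (starRingEnd ℂ) (G a')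

theorem conj_mem_weightSpace {χ : AddChar k ℂ} {A : Subalgebra ℂ (Module.End ℂ (kˣ → ℂ))}
    (hA : IsInductive χ A) {b : k} {T : Module.End ℂ (kˣ → ℂ)} (hT : T ∈ weightSpace χ A b)
    (a : kˣ) :
    (piRep χ a 0).toLinearMap * T * (piRep χ a 0).symm.toLinearMap ∈
      weightSpace χ A (b * (a⁻¹ : kˣ)) := by
  refine ⟨hA.2 T hT.1 a 0, fun b' => ?_⟩
  have hfun : (piRep χ 1 b').toLinearMap * (piRep χ a 0).toLinearMap =
      (piRep χ a 0).toLinearMap * (piRep χ 1 ((a⁻¹ : kˣ) * b')).toLinearMap := by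
    refine LinearMap.ext fun F => funext fun x => ?_
    simp [piRep, mul_assoc]
  have hinv : (piRep χ a 0).symm.toLinearMap * (piRep χ 1 b').symm.toLinearMap =
      (piRep χ 1 ((a⁻¹ : kˣ) * b')).symm.toLinearMap * (piRep χ a 0).symm.toLinearMap := by
    refine LinearMap.ext fun F => funext fun x => ?_
    simp [piRep, mul_assoc]
  have hw := hT.2 ((a⁻¹ : kˣ) * b')
  calc _ = ((piRep χ 1 b').toLinearMap * (piRep χ a 0).toLinearMap) * T *
        ((piRep χ a 0).symm.toLinearMap * (piRep χ 1 b').symm.toLinearMap) := by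
        simp only [mul_assoc]
    _ = (piRep χ a 0).toLinearMap * ((piRep χ 1 ((a⁻¹ : kˣ) * b')).toLinearMap * T *
        (piRep χ 1 ((a⁻¹ : kˣ) * b')).symm.toLinearMap) * (piRep χ a 0).symm.toLinearMap := by
        rw [hfun, hinv]; simp only [mul_assoc]
    _ = _ := by rw [hw, mul_smul_comm, smul_mul_assoc, mul_assoc b]

theorem one_mem_weightSpace_zero (χ : AddChar k ℂ) (A : Subalgebra ℂ (Module.End ℂ (kˣ → ℂ))) :
    1 ∈ weightSpace χ A 0 := by
  refine ⟨one_mem A, fun b' => LinearMap.ext fun F => ?_⟩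
  simp

/-- A nonzero matrix entry of an operator of weight `b` sits on the diagonal `x - y = b`. -/
theorem eq_sub_of_mem_weightSpace [DecidableEq k] {χ : AddChar k ℂ} (hχ : χ ≠ 1)
    {A : Subalgebra ℂ (Module.End ℂ (kˣ → ℂ))} {b : k} {T : Module.End ℂ (kˣ → ℂ)}
    (hT : T ∈ weightSpace χ A b) {x y : kˣ} (hxy : T (Pi.single y 1) x ≠ 0) :
    b = x - y := by
  have hb (b' : k) : χ (x * b' - y * b') = χ (b * b') := by
    have h := congrFun (LinearMap.congr_fun (hT.2 b') (Pi.single y 1)) x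
    have hs : (piRep χ 1 b').symm (Pi.single y 1) =
        χ (-(y * b')) • (Pi.single y 1 : kˣ → ℂ) := by
      funext z
      by_cases hz : z = y
      · subst hz; simp [piRep]
      · simp [piRep, hz]
    simp only [Module.End.mul_apply, LinearEquiv.coe_coe, hs, map_smul, LinearMap.smul_apply,
      Pi.smul_apply, smul_eq_mul] at h
    have hp (F : kˣ → ℂ) : piRep χ 1 b' F x = χ (x * b') * F x := by simp [piRep]
    rw [hp, ← mul_assoc, mul_comm (χ (-_)), ← AddChar.map_add_eq_mul, ← sub_eq_add_neg] at h
    exact mul_right_cancel₀ hxy h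
  by_contra hne
  refine AddChar.IsPrimitive.of_ne_one hχ (sub_ne_zero.mpr hne) ?_
  ext c
  have h := hb c
  rw [AddChar.mulShift_apply, AddChar.one_apply, sub_mul, sub_mul, AddChar.map_sub_eq_div, h,
    div_self (χ.val_isUnit _).ne_zero]

theorem linearIndependent_of_mem_weightSpace [Finite k] {χ : AddChar k ℂ} (hχ : χ ≠ 1)
    {A : Subalgebra ℂ (Module.End ℂ (kˣ → ℂ))} {T : k → Module.End ℂ (kˣ → ℂ)}
    (hT : ∀ b, T b ∈ weightSpace χ A b) (hT₀ : ∀ b, T b ≠ 0) :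
    LinearIndependent ℂ T := by
  classical
  have := Fintype.ofFinite k
  rw [Fintype.linearIndependent_iff]
  intro g hg b
  obtain ⟨x, y, hxy⟩ : ∃ x y : kˣ, T b (Pi.single y 1) x ≠ 0 := by
    by_contra! h
    refine hT₀ b (LinearMap.pi_ext' fun y => LinearMap.ext_ring (funext fun x => ?_))
    simpa using h x y
  have h := congrFun (LinearMap.congr_fun hg (Pi.single y 1)) x
  rw [LinearMap.sum_apply, Finset.sum_apply, Finset.sum_eq_single b] at h
  · simpa [hxy] using h
  · intro c _ hc
    by_contra h'
    refine hc ((eq_sub_of_mem_weightSpace hχ (hT c) fun h0 => h' ?_).trans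
      (eq_sub_of_mem_weightSpace hχ (hT b) hxy).symm)
    simp [h0]
  · simp

theorem exists_mem_weightSpace_ne_zero {χ : AddChar k ℂ}
    {A : Subalgebra ℂ (Module.End ℂ (kˣ → ℂ))} (hA : IsInductive χ A)
    (h1 : weightSpace χ A 1 ≠ ⊥) (b : k) : ∃ T ∈ weightSpace χ A b, T ≠ 0 := by
  obtain rfl | hb := eq_or_ne b 0
  · exact ⟨1, one_mem_weightSpace_zero χ A, one_ne_zero⟩
  · obtain ⟨T, hT, hT₀⟩ := Submodule.exists_mem_ne_zero_of_ne_bot h1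
    refine ⟨_, by simpa using conj_mem_weightSpace hA hT (Units.mk0 b hb)⁻¹, fun h => hT₀ ?_⟩
    exact (piRep χ (Units.mk0 b hb)⁻¹ 0).conj.map_eq_zero_iff.mp h

/-- If `A_1 ≠ 0` then `dim A_b ≥ 1` for every `b ∈ k`, and hence
`dim A ≥ q`. -/
theorem weightSpace_one_ne_bot_dim_ge
    {k : Type*} [Field k] [Fintype k]
    (χ : AddChar k ℂ) (hχ : χ ≠ 1)
    (A : Subalgebra ℂ (Module.End ℂ (kˣ → ℂ)))
    (hA : IsInductive χ A)
    (h1 : weightSpace χ A 1 ≠ ⊥) :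
    (∀ b : k, 1 ≤ Module.finrank ℂ (weightSpace χ A b)) ∧
      Fintype.card k ≤ Module.finrank ℂ A := by
  choose T hT hT₀ using exists_mem_weightSpace_ne_zero hA h1
  refine ⟨fun b => ?_, ?_⟩
  · rw [Submodule.one_le_finrank_iff]
    exact (Submodule.ne_bot_iff _).mpr ⟨T b, hT b, hT₀ b⟩
  · have hli : LinearIndependent ℂ fun b => (⟨T b, (hT b).1⟩ : A) :=
      LinearIndependent.of_comp A.val.toLinearMap
        (linearIndependent_of_mem_weightSpace hχ hT hT₀)
    exact hli.fintype_card_le_finrank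

end AffineInductive
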